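/- arXiv:1906.07759 — 2 statements merged into one kernel-verified Lean document; each statement's English description precedes it below -/
import Mathlib

section
/- If 0 < λ < sup_{t>0} Λ^n(t), then the function t ↦ R^n_λ(t) on (0,∞) has exactly two critical points 0 < t^{n,+} < t^{n,-}; t^{n,+} is a local minimum point with (R^n_λ)''(t^{n,+}) > 0, and t^{n,-} is a local maximum point with (R^n_λ)''(t^{n,-}) < 0. Moreover, Λ^n(t^{n,+}) = Λ^n(t^{n,-}) = λ. -/
open Real Filter Topology

noncomputable section

/-- The fibering function `Λ^e(t)` (with `a,b,c` playing the roles of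
`‖u‖₁², ‖u‖_{L^q}^q, ‖u‖_{L^γ}^γ`). -/
def LamE (q α γ a b c : ℝ) (t : ℝ) : ℝ :=
  q / ((α - q) * b) * ((2 - α) / 2 * a * t ^ ((2 : ℝ) - q) - (γ - α) / γ * c * t ^ (γ - q))

/-- The fibering function `Λ^n(t)`. -/
def LamN (q α γ a b c : ℝ) (t : ℝ) : ℝ :=
  1 / ((α - q) * b) * ((2 - α) * a * t ^ ((2 : ℝ) - q) - (γ - α) * c * t ^ (γ - q))

/-- The fibering function `R^e_λ(t)` (with `d` playing the role of `‖u‖_{L^α}^α`). -/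
def ReF (q α γ a b c d lam : ℝ) (t : ℝ) : ℝ :=
  α / d * (a / 2 * t ^ ((2 : ℝ) - α) + lam * b / q * t ^ (q - α) - c / γ * t ^ (γ - α))

/-- The fibering function `R^n_λ(t)`. -/
def RnF (q α γ a b c d lam : ℝ) (t : ℝ) : ℝ :=
  1 / d * (a * t ^ ((2 : ℝ) - α) + lam * b * t ^ (q - α) - c * t ^ (γ - α))

/-- The point `t^e = (C_e·a/c)^{1/(γ-2)}`, `C_e = γ(2-α)(2-q)/(2(γ-α)(γ-q))`,
the global maximum point of `Λ^e`. -/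
def tEmax (q α γ a c : ℝ) : ℝ :=
  (γ * (2 - α) * (2 - q) / (2 * (γ - α) * (γ - q)) * a / c) ^ ((1 : ℝ) / (γ - 2))

/-- The derivative of `t ↦ A * t ^ p - C * t ^ s` at a positive point. -/
theorem hasDerivAt_rpow_sub_rpow (A C p s : ℝ) {t : ℝ} (ht : 0 < t) :
    HasDerivAt (fun x : ℝ => A * x ^ p - C * x ^ s)
      (t ^ (p - 1) * (A * p - C * s * t ^ (s - p))) t := by
  have h₁ := (Real.hasDerivAt_rpow_const (p := p) (Or.inl ht.ne')).const_mul A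
  have h₂ := (Real.hasDerivAt_rpow_const (p := s) (Or.inl ht.ne')).const_mul C
  refine (h₁.sub h₂).congr_deriv ?_
  have h : t ^ (s - 1) = t ^ (p - 1) * t ^ (s - p) := by
    rw [← rpow_add ht]
    ring_nf
  rw [h]
  ring

/-- A positive level below some value of `t ↦ A * t ^ p - C * t ^ s` with `0 < p < s` is attained
exactly twice on `(0, ∞)`, first increasingly and then decreasingly. -/
theorem exists_two_eq_rpow_sub_rpow {A C p s m t₁ : ℝ} (hA : 0 < A) (hC : 0 < C) (hp : 0 < p)
    (hps : p < s) (hm : 0 < m) (ht₁ : 0 < t₁) (hmt₁ : m < A * t₁ ^ p - C * t₁ ^ s) :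
    ∃ x y : ℝ, 0 < x ∧ x < y ∧ A * x ^ p - C * x ^ s = m ∧ A * y ^ p - C * y ^ s = m ∧
      0 < A * p - C * s * x ^ (s - p) ∧ A * p - C * s * y ^ (s - p) < 0 ∧
      ∀ t > (0 : ℝ), A * t ^ p - C * t ^ s = m → t = x ∨ t = y := by
  have hs : 0 < s := hp.trans hps
  have hsp : 0 < s - p := sub_pos.2 hps
  set G : ℝ → ℝ := fun x => A * x ^ p - C * x ^ s with hG
  have hcont : Continuous G :=
    ((continuous_rpow_const hp.le).const_mul A).sub ((continuous_rpow_const hs.le).const_mul C)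
  set t₀ : ℝ := (A * p / (C * s)) ^ (s - p)⁻¹ with ht₀_def
  set T : ℝ := (A / C) ^ (s - p)⁻¹ with hT_def
  have ht₀ : 0 < t₀ := by positivity
  have hT : 0 < T := by positivity
  have ht₀_pow : t₀ ^ (s - p) = A * p / (C * s) := rpow_inv_rpow (by positivity) hsp.ne'
  have hT_pow : T ^ (s - p) = A / C := rpow_inv_rpow (by positivity) hsp.ne'
  have ht₀T : t₀ < T := by
    refine rpow_lt_rpow (by positivity) ?_ (inv_pos.2 hsp)
    rw [div_lt_div_iff₀ (by positivity) hC]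
    nlinarith [mul_pos hA hC]
  have hslope_pos : ∀ t, 0 < t → t < t₀ → 0 < A * p - C * s * t ^ (s - p) := by
    intro t ht h
    have := rpow_lt_rpow ht.le h hsp
    rw [ht₀_pow, lt_div_iff₀ (by positivity)] at this
    linarith
  have hslope_neg : ∀ t, t₀ < t → A * p - C * s * t ^ (s - p) < 0 := by
    intro t h
    have := rpow_lt_rpow ht₀.le h hsp
    rw [ht₀_pow, div_lt_iff₀ (by positivity)] at this
    linarith
  have hmono : StrictMonoOn G (Set.Icc 0 t₀) := by
    refine strictMonoOn_of_deriv_pos (convex_Icc _ _) hcont.continuousOn fun t ht => ?_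
    rw [interior_Icc] at ht
    rw [(hasDerivAt_rpow_sub_rpow A C p s ht.1).deriv]
    exact mul_pos (rpow_pos_of_pos ht.1 _) (hslope_pos t ht.1 ht.2)
  have hanti : StrictAntiOn G (Set.Ici t₀) := by
    refine strictAntiOn_of_deriv_neg (convex_Ici _) hcont.continuousOn fun t ht => ?_
    rw [interior_Ici] at ht
    have ht' : 0 < t := ht₀.trans ht
    rw [(hasDerivAt_rpow_sub_rpow A C p s ht').deriv]
    exact mul_neg_of_pos_of_neg (rpow_pos_of_pos ht' _) (hslope_neg t ht)
  have hG0 : G 0 = 0 := by simp [hG, zero_rpow hp.ne', zero_rpow hs.ne']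
  have hGT : G T = 0 := by
    have h : T ^ s = T ^ p * (A / C) := by
      rw [← hT_pow, ← rpow_add hT]
      ring_nf
    simp only [hG, h]
    field_simp
    ring
  have hmt₀ : m < G t₀ := by
    refine hmt₁.trans_le ?_
    rcases le_total t₁ t₀ with h | h
    · exact hmono.monotoneOn ⟨ht₁.le, h⟩ ⟨ht₀.le, le_rfl⟩ h
    · exact hanti.antitoneOn (Set.mem_Ici.2 le_rfl) h h
  obtain ⟨x, hx, hGx⟩ :=
    intermediate_value_Ioo ht₀.le hcont.continuousOn ⟨by rwa [hG0], hmt₀⟩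
  obtain ⟨y, hy, hGy⟩ :=
    intermediate_value_Ioo' ht₀T.le hcont.continuousOn ⟨by rwa [hGT], hmt₀⟩
  refine ⟨x, y, hx.1, hx.2.trans hy.1, hGx, hGy, hslope_pos x hx.1 hx.2, hslope_neg y hy.1,
    fun t ht hGt => ?_⟩
  rcases le_total t t₀ with h | h
  · exact Or.inl (hmono.injOn ⟨ht.le, h⟩ ⟨hx.1.le, hx.2.le⟩ (hGt.trans hGx.symm))
  · exact Or.inr (hanti.injOn h hy.1.le (hGt.trans hGy.symm))

/-- The derivative of `R^n_λ` in terms of the numerator of `Λ^n`. -/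
theorem hasDerivAt_RnF (q α γ a b c d lam : ℝ) {t : ℝ} (ht : 0 < t) :
    HasDerivAt (RnF q α γ a b c d lam)
      (1 / d * t ^ (q - α - 1) * ((2 - α) * a * t ^ ((2 : ℝ) - q) - (γ - α) * c * t ^ (γ - q)
        - (α - q) * b * lam)) t := by
  have h₁ := (Real.hasDerivAt_rpow_const (p := (2 : ℝ) - α) (Or.inl ht.ne')).const_mul a
  have h₂ := (Real.hasDerivAt_rpow_const (p := q - α) (Or.inl ht.ne')).const_mul (lam * b)
  have h₃ := (Real.hasDerivAt_rpow_const (p := γ - α) (Or.inl ht.ne')).const_mul c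
  refine (((h₁.add h₂).sub h₃).const_mul (1 / d)).congr_deriv ?_
  have e₁ : t ^ ((2 : ℝ) - α - 1) = t ^ (q - α - 1) * t ^ ((2 : ℝ) - q) := by
    rw [← rpow_add ht]
    ring_nf
  have e₂ : t ^ (γ - α - 1) = t ^ (q - α - 1) * t ^ (γ - q) := by
    rw [← rpow_add ht]
    ring_nf
  rw [e₁, e₂]
  ring

/-- The second derivative of `R^n_λ` where `Λ^n` takes the value `λ`. -/
theorem deriv_deriv_RnF {q α γ a b c d lam t : ℝ} (ht : 0 < t)
    (hlam : (2 - α) * a * t ^ ((2 : ℝ) - q) - (γ - α) * c * t ^ (γ - q) = (α - q) * b * lam) :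
    deriv (deriv (RnF q α γ a b c d lam)) t =
      1 / d * t ^ (q - α - 1) * (t ^ ((2 : ℝ) - q - 1) * ((2 - α) * a * (2 - q)
        - (γ - α) * c * (γ - q) * t ^ (γ - q - (2 - q)))) := by
  have hev : deriv (RnF q α γ a b c d lam) =ᶠ[𝓝 t] fun x =>
      1 / d * x ^ (q - α - 1) * ((2 - α) * a * x ^ ((2 : ℝ) - q) - (γ - α) * c * x ^ (γ - q)
        - (α - q) * b * lam) := by
    filter_upwards [lt_mem_nhds ht] with x hx using (hasDerivAt_RnF q α γ a b c d lam hx).deriv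
  rw [hev.deriv_eq]
  have h₁ := (Real.hasDerivAt_rpow_const (p := q - α - 1) (Or.inl ht.ne')).const_mul (1 / d)
  have h₂ := (hasDerivAt_rpow_sub_rpow ((2 - α) * a) ((γ - α) * c) (2 - q) (γ - q) ht).sub_const
    ((α - q) * b * lam)
  refine (h₁.mul h₂).deriv.trans ?_
  rw [hlam]
  ring

/-- for `0 < λ < sup_{t>0} Λ^n(t)`, the function `R^n_λ` has exactly two
critical points `0 < t^{n,+} < t^{n,-}` on `(0,∞)`; `t^{n,+}` is a local minimum with
`(R^n_λ)'' > 0` there, `t^{n,-}` a local maximum with `(R^n_λ)'' < 0` there; moreover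
`Λ^n = λ` at both points. -/
theorem RnF_two_critical_points (q α γ a b c d : ℝ)
    (hq : 1 < q) (hqα : q < α) (hα : α < 2) (hγ : 2 < γ)
    (ha : 0 < a) (hb : 0 < b) (hc : 0 < c) (hd : 0 < d)
    (lam : ℝ) (hlam0 : 0 < lam)
    (hlam : lam < sSup {y | ∃ t > (0 : ℝ), y = LamN q α γ a b c t}) :
    ∃ tp tm : ℝ, 0 < tp ∧ tp < tm ∧
      deriv (RnF q α γ a b c d lam) tp = 0 ∧
      deriv (RnF q α γ a b c d lam) tm = 0 ∧
      (∀ t > (0 : ℝ), deriv (RnF q α γ a b c d lam) t = 0 → t = tp ∨ t = tm) ∧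
      IsLocalMin (RnF q α γ a b c d lam) tp ∧
      0 < deriv (deriv (RnF q α γ a b c d lam)) tp ∧
      IsLocalMax (RnF q α γ a b c d lam) tm ∧
      deriv (deriv (RnF q α γ a b c d lam)) tm < 0 ∧
      LamN q α γ a b c tp = lam ∧ LamN q α γ a b c tm = lam := by
  have hK : 0 < (α - q) * b := mul_pos (sub_pos.2 hqα) hb
  have hLam : ∀ t l : ℝ, LamN q α γ a b c t = l ↔
      (2 - α) * a * t ^ ((2 : ℝ) - q) - (γ - α) * c * t ^ (γ - q) = (α - q) * b * l := by
    intro t l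
    rw [LamN, one_div, inv_mul_eq_iff_eq_mul₀ hK.ne']
  obtain ⟨_, ⟨t₁, ht₁, rfl⟩, hlt⟩ := exists_lt_of_lt_csSup (by exact ⟨_, 1, one_pos, rfl⟩) hlam
  have hlt' : (α - q) * b * lam <
      (2 - α) * a * t₁ ^ ((2 : ℝ) - q) - (γ - α) * c * t₁ ^ (γ - q) := by
    rw [(hLam t₁ _).1 rfl]
    exact mul_lt_mul_of_pos_left hlt hK
  obtain ⟨x, y, hx, hxy, hGx, hGy, hsx, hsy, huniq⟩ :=
    exists_two_eq_rpow_sub_rpow (mul_pos (sub_pos.2 hα) ha)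
      (mul_pos (sub_pos.2 (hα.trans hγ)) hc) (by linarith : (0 : ℝ) < 2 - q)
      (by linarith : 2 - q < γ - q) (mul_pos hK hlam0) ht₁ hlt'
  have hy : 0 < y := hx.trans hxy
  have hdx : deriv (RnF q α γ a b c d lam) x = 0 := by
    rw [(hasDerivAt_RnF q α γ a b c d lam hx).deriv, hGx, sub_self, mul_zero]
  have hdy : deriv (RnF q α γ a b c d lam) y = 0 := by
    rw [(hasDerivAt_RnF q α γ a b c d lam hy).deriv, hGy, sub_self, mul_zero]
  have hddx : 0 < deriv (deriv (RnF q α γ a b c d lam)) x := by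
    rw [deriv_deriv_RnF hx hGx]
    exact mul_pos (by positivity) (mul_pos (by positivity) hsx)
  have hddy : deriv (deriv (RnF q α γ a b c d lam)) y < 0 := by
    rw [deriv_deriv_RnF hy hGy]
    exact mul_neg_of_pos_of_neg (by positivity) (mul_neg_of_pos_of_neg (by positivity) hsy)
  refine ⟨x, y, hx, hxy, hdx, hdy, fun t ht h => huniq t ht ?_,
    isLocalMin_of_deriv_deriv_pos hddx hdx (hasDerivAt_RnF q α γ a b c d lam hx).continuousAt,
    hddx,
    isLocalMax_of_deriv_deriv_neg hddy hdy (hasDerivAt_RnF q α γ a b c d lam hy).continuousAt,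
    hddy, (hLam x lam).2 hGx, (hLam y lam).2 hGy⟩
  rw [(hasDerivAt_RnF q α γ a b c d lam ht).deriv] at h
  exact sub_eq_zero.1 ((mul_eq_zero.1 h).resolve_left (by positivity))

end
end

section
/- For each λ with 0 < λ < sup_{t>0} Λ^e(t), the critical points of R^e_λ and R^n_λ interlace as t^{n,+}_λ < t^{e,+}_λ < t^e < t^{n,-}_λ < t^{e,-}_λ, where t^e = (C_e·a/c)^{1/(γ−2)}, C_e = γ(2−α)(2−q)/(2(γ−α)(γ−q)), is the global maximum point of Λ^e. -/
open Real Filter Topology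

noncomputable section

/-- For `0 < p < r` and `B > 0` the function `t ↦ A * t ^ p - B * t ^ r` is strictly quasiconcave on
the positive reals: it is strictly concave in the variable `t ^ p`. -/
theorem min_lt_rpow_sub_rpow {p r A B x y z : ℝ} (hp : 0 < p) (hpr : p < r) (hB : 0 < B)
    (hx : 0 < x) (hxy : x < y) (hyz : y < z) :
    min (A * x ^ p - B * x ^ r) (A * z ^ p - B * z ^ r) < A * y ^ p - B * y ^ r := by
  have hy := hx.trans hxy
  have hz := hy.trans hyz
  have key : ∀ t : ℝ, 0 < t → t ^ r = (t ^ p) ^ (r / p) := fun t ht => by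
    rw [← rpow_mul ht.le, mul_div_cancel₀ _ hp.ne']
  have hconv := strictConvexOn_rpow ((one_lt_div hp).2 hpr)
  have h1 : x ^ p < y ^ p := rpow_lt_rpow hx.le hxy hp
  have h2 : y ^ p < z ^ p := rpow_lt_rpow hy.le hyz hp
  rw [key x hx, key y hy, key z hz]
  have hX : 0 < x ^ p := rpow_pos_of_pos hx p
  have hconc : StrictConcaveOn ℝ (Set.Ici 0) fun w : ℝ => A * w - B * w ^ (r / p) := by
    refine ⟨hconv.1, fun v hv w hw hvw m n hm hn hmn => ?_⟩
    have h := mul_lt_mul_of_pos_left (hconv.2 hv hw hvw hm hn hmn) hB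
    simp only [smul_eq_mul] at h ⊢
    linarith
  refine hconc.lt_on_openSegment (x := x ^ p) (y := z ^ p) hX.le (hX.trans (h1.trans h2)).le
    (h1.trans h2).ne ?_
  rw [openSegment_eq_Ioo (h1.trans h2)]
  exact ⟨h1, h2⟩

/-- A critical point of `t ↦ A * t ^ p - B * t ^ r` is a global maximum on the positive reals. -/
theorem rpow_sub_rpow_le_of_critical {p r A B T t : ℝ} (hp : 0 < p) (hpr : p < r) (hB : 0 < B)
    (hT : 0 < T) (ht : 0 < t) (hcrit : p * (A * T ^ p) = r * (B * T ^ r)) :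
    A * t ^ p - B * t ^ r ≤ A * T ^ p - B * T ^ r := by
  have hu : 0 < t / T := div_pos ht hT
  have hbern : 1 + r / p * ((t / T) ^ p - 1) ≤ (t / T) ^ r := by
    have h := one_add_mul_self_le_rpow_one_add (s := (t / T) ^ p - 1) (p := r / p)
      (by linarith [rpow_pos_of_pos hu p]) ((one_le_div hp).2 hpr.le)
    rwa [add_sub_cancel, ← rpow_mul hu.le, mul_div_cancel₀ _ hp.ne'] at h
  have split : ∀ e : ℝ, t ^ e = T ^ e * (t / T) ^ e := fun e => by
    rw [← mul_rpow hT.le hu.le, mul_div_cancel₀ _ hT.ne']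
  have hA : A * T ^ p = r / p * (B * T ^ r) := by
    field_simp
    linarith
  have h := mul_le_mul_of_nonneg_left hbern (mul_pos hB (rpow_pos_of_pos hT r)).le
  rw [split p, split r, ← mul_assoc, ← mul_assoc, hA]
  linarith

theorem lamE_eq (q α γ a b c t : ℝ) :
    LamE q α γ a b c t = q / ((α - q) * b) * ((2 - α) / 2 * a) * t ^ (2 - q) -
      q / ((α - q) * b) * ((γ - α) / γ * c) * t ^ (γ - q) := by
  unfold LamE
  ring

theorem lamN_eq (q α γ a b c t : ℝ) :
    LamN q α γ a b c t = 1 / ((α - q) * b) * ((2 - α) * a) * t ^ (2 - q) -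
      1 / ((α - q) * b) * ((γ - α) * c) * t ^ (γ - q) := by
  unfold LamN
  ring

theorem min_lt_lamE {q α γ a b c x y z : ℝ} (hq : 0 < q) (hqα : q < α) (hα : α < 2) (hγ : 2 < γ)
    (hb : 0 < b) (hc : 0 < c) (hx : 0 < x) (hxy : x < y) (hyz : y < z) :
    min (LamE q α γ a b c x) (LamE q α γ a b c z) < LamE q α γ a b c y := by
  have h1 := sub_pos.2 hqα
  have h2 : 0 < γ - α := by linarith
  have h3 : 0 < γ := by linarith
  simp only [lamE_eq]
  exact min_lt_rpow_sub_rpow (by linarith) (by linarith) (by positivity) hx hxy hyz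

theorem min_lt_lamN {q α γ a b c x y z : ℝ} (hqα : q < α) (hα : α < 2) (hγ : 2 < γ)
    (hb : 0 < b) (hc : 0 < c) (hx : 0 < x) (hxy : x < y) (hyz : y < z) :
    min (LamN q α γ a b c x) (LamN q α γ a b c z) < LamN q α γ a b c y := by
  have h1 := sub_pos.2 hqα
  have h2 : 0 < γ - α := by linarith
  simp only [lamN_eq]
  exact min_lt_rpow_sub_rpow (by linarith) (by linarith) (by positivity) hx hxy hyz

theorem tEmax_pos {q α γ a c : ℝ} (hqα : q < α) (hα : α < 2) (hγ : 2 < γ) (ha : 0 < a)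
    (hc : 0 < c) : 0 < tEmax q α γ a c := by
  have h1 : 0 < 2 - α := by linarith
  have h2 : 0 < 2 - q := by linarith
  have h3 : 0 < γ - α := by linarith
  have h4 : 0 < γ - q := by linarith
  have h5 : 0 < γ := by linarith
  unfold tEmax
  positivity

theorem tEmax_rpow {q α γ a c : ℝ} (hqα : q < α) (hα : α < 2) (hγ : 2 < γ) (ha : 0 < a)
    (hc : 0 < c) : tEmax q α γ a c ^ (γ - 2) =
      γ * (2 - α) * (2 - q) / (2 * (γ - α) * (γ - q)) * a / c := by
  have h1 : 0 < 2 - α := by linarith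
  have h2 : 0 < 2 - q := by linarith
  have h3 : 0 < γ - α := by linarith
  have h4 : 0 < γ - q := by linarith
  have h5 : 0 < γ := by linarith
  unfold tEmax
  rw [← rpow_mul (by positivity), one_div_mul_cancel (by linarith), rpow_one]

/-- The difference `Λ^n - Λ^e` is a positive multiple of `(t^e) ^ (γ - 2) - t ^ (γ - 2)`. -/
theorem lamN_sub_lamE {q α γ a b c t : ℝ} (hqα : q < α) (hα : α < 2) (hγ : 2 < γ) (ha : 0 < a)
    (hb : 0 < b) (hc : 0 < c) (ht : 0 < t) :
    LamN q α γ a b c t - LamE q α γ a b c t =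
      (γ - α) * (γ - q) * c / (γ * ((α - q) * b)) * t ^ (2 - q) *
        (tEmax q α γ a c ^ (γ - 2) - t ^ (γ - 2)) := by
  have h1 : α - q ≠ 0 := by linarith
  have h3 : γ - α ≠ 0 := by linarith
  have h4 : γ - q ≠ 0 := by linarith
  have h5 : γ ≠ 0 := by linarith
  have hs : t ^ (γ - q) = t ^ (2 - q) * t ^ (γ - 2) := by
    rw [← rpow_add ht]
    ring_nf
  rw [tEmax_rpow hqα hα hγ ha hc, LamN, LamE, hs]
  field_simp
  ring

theorem lamE_le_lamE_tEmax {q α γ a b c t : ℝ} (hq : 0 < q) (hqα : q < α) (hα : α < 2)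
    (hγ : 2 < γ) (ha : 0 < a) (hb : 0 < b) (hc : 0 < c) (ht : 0 < t) :
    LamE q α γ a b c t ≤ LamE q α γ a b c (tEmax q α γ a c) := by
  have h1 := sub_pos.2 hqα
  have h3 : 0 < γ - α := by linarith
  have h4 : 0 < γ - q := by linarith
  have h5 : 0 < γ := by linarith
  have hT := tEmax_pos hqα hα hγ ha hc
  have hs : tEmax q α γ a c ^ (γ - q) =
      tEmax q α γ a c ^ (2 - q) * tEmax q α γ a c ^ (γ - 2) := by
    rw [← rpow_add hT]
    ring_nf
  simp only [lamE_eq]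
  refine rpow_sub_rpow_le_of_critical (by linarith) (by linarith) (by positivity) hT ht ?_
  rw [hs, tEmax_rpow hqα hα hγ ha hc]
  field_simp

theorem hasDerivAt_rnF {q α γ a b c d lam t : ℝ} (hqα : q < α) (hb : 0 < b) (ht : 0 < t) :
    HasDerivAt (RnF q α γ a b c d lam)
      (1 / d * ((α - q) * b) * t ^ (q - α - 1) * (LamN q α γ a b c t - lam)) t := by
  have h1 : α - q ≠ 0 := by linarith
  have hp : ∀ e : ℝ, HasDerivAt (fun x : ℝ => x ^ e) (e * t ^ (e - 1)) t := fun e =>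
    hasDerivAt_rpow_const (Or.inl ht.ne')
  have h := ((((hp (2 - α)).const_mul a).add ((hp (q - α)).const_mul (lam * b))).sub
    ((hp (γ - α)).const_mul c)).const_mul (1 / d)
  refine h.congr_deriv ?_
  have e1 : t ^ (2 - α - 1) = t ^ (q - α - 1) * t ^ (2 - q) := by
    rw [← rpow_add ht]
    ring_nf
  have e2 : t ^ (γ - α - 1) = t ^ (q - α - 1) * t ^ (γ - q) := by
    rw [← rpow_add ht]
    ring_nf
  rw [e1, e2, LamN]
  field_simp
  ring

theorem hasDerivAt_reF {q α γ a b c d lam t : ℝ} (hq : 0 < q) (hqα : q < α) (hγ : 0 < γ)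
    (hb : 0 < b) (ht : 0 < t) :
    HasDerivAt (ReF q α γ a b c d lam)
      (α / d * ((α - q) * b / q) * t ^ (q - α - 1) * (LamE q α γ a b c t - lam)) t := by
  have h1 : α - q ≠ 0 := by linarith
  have hp : ∀ e : ℝ, HasDerivAt (fun x : ℝ => x ^ e) (e * t ^ (e - 1)) t := fun e =>
    hasDerivAt_rpow_const (Or.inl ht.ne')
  have h := ((((hp (2 - α)).const_mul (a / 2)).add ((hp (q - α)).const_mul (lam * b / q))).sub
    ((hp (γ - α)).const_mul (c / γ))).const_mul (α / d)
  refine h.congr_deriv ?_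
  have e1 : t ^ (2 - α - 1) = t ^ (q - α - 1) * t ^ (2 - q) := by
    rw [← rpow_add ht]
    ring_nf
  have e2 : t ^ (γ - α - 1) = t ^ (q - α - 1) * t ^ (γ - q) := by
    rw [← rpow_add ht]
    ring_nf
  rw [e1, e2, LamE]
  field_simp
  ring

theorem lamN_eq_of_deriv_rnF_eq_zero {q α γ a b c d lam t : ℝ} (hqα : q < α) (hb : 0 < b)
    (hd : 0 < d) (ht : 0 < t) (h : deriv (RnF q α γ a b c d lam) t = 0) :
    LamN q α γ a b c t = lam := by
  rw [(hasDerivAt_rnF hqα hb ht).deriv] at h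
  have h1 := sub_pos.2 hqα
  exact sub_eq_zero.1 ((mul_eq_zero.1 h).resolve_left (by positivity))

theorem lamE_eq_of_deriv_reF_eq_zero {q α γ a b c d lam t : ℝ} (hq : 0 < q) (hqα : q < α)
    (hγ : 0 < γ) (hb : 0 < b) (hd : 0 < d) (ht : 0 < t)
    (h : deriv (ReF q α γ a b c d lam) t = 0) : LamE q α γ a b c t = lam := by
  rw [(hasDerivAt_reF hq hqα hγ hb ht).deriv] at h
  have h1 := sub_pos.2 hqα
  have h2 := hq.trans hqα
  exact sub_eq_zero.1 ((mul_eq_zero.1 h).resolve_left (by positivity))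

/-- If `f` is strictly quasiconcave on the positive reals and takes the value `l` at `s < u`, then
any positive point where `f` exceeds `l` lies strictly between `s` and `u`. -/
theorem mem_Ioo_of_lt_of_quasiconcave {f : ℝ → ℝ}
    (hf : ∀ x y z : ℝ, 0 < x → x < y → y < z → min (f x) (f z) < f y) {l s t u : ℝ}
    (hs : 0 < s) (hsu : s < u) (hfs : f s = l) (hfu : f u = l) (ht : 0 < t) (hft : l < f t) :
    t ∈ Set.Ioo s u := by
  constructor
  · by_contra! hle
    rcases hle.eq_or_lt with rfl | hlt
    · exact hft.ne' hfs
    · have := hf t s u ht hlt hsu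
      rw [hfs, hfu, min_eq_right hft.le] at this
      exact this.false
  · by_contra! hle
    rcases hle.eq_or_lt with rfl | hlt
    · exact hft.ne' hfu
    · have := hf s u t hs hsu hlt
      rw [hfs, hfu, min_eq_left hft.le] at this
      exact this.false

/-- for `0 < λ < sup_{t>0} Λ^e(t)`, the two critical points of `R^e_λ`
and of `R^n_λ` interlace as `t^{n,+} < t^{e,+} < t^e < t^{n,-} < t^{e,-}`. -/
theorem critical_points_interlace (q α γ a b c d : ℝ)
    (hq : 1 < q) (hqα : q < α) (hα : α < 2) (hγ : 2 < γ)
    (ha : 0 < a) (hb : 0 < b) (hc : 0 < c) (hd : 0 < d)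
    (lam : ℝ) (hlam0 : 0 < lam)
    (hlam : lam < sSup {y | ∃ t > (0 : ℝ), y = LamE q α γ a b c t}) :
    ∀ tnp tnm tep tem : ℝ,
      0 < tnp → tnp < tnm →
      deriv (RnF q α γ a b c d lam) tnp = 0 → deriv (RnF q α γ a b c d lam) tnm = 0 →
      0 < tep → tep < tem →
      deriv (ReF q α γ a b c d lam) tep = 0 → deriv (ReF q α γ a b c d lam) tem = 0 →
      tnp < tep ∧ tep < tEmax q α γ a c ∧ tEmax q α γ a c < tnm ∧ tnm < tem := by
  intro tnp tnm tep tem hnp hn dnp dnm hep he dep dem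
  have hq0 : 0 < q := by linarith
  have hγ0 : 0 < γ := by linarith
  have hT := tEmax_pos hqα hα hγ ha hc
  have hNp := lamN_eq_of_deriv_rnF_eq_zero hqα hb hd hnp dnp
  have hNm := lamN_eq_of_deriv_rnF_eq_zero hqα hb hd (hnp.trans hn) dnm
  have hEp := lamE_eq_of_deriv_reF_eq_zero hq0 hqα hγ0 hb hd hep dep
  have hEm := lamE_eq_of_deriv_reF_eq_zero hq0 hqα hγ0 hb hd (hep.trans he) dem
  have hqcN := fun x y z => min_lt_lamN (a := a) (x := x) (y := y) (z := z) hqα hα hγ hb hc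
  have hqcE := fun x y z => min_lt_lamE (a := a) (x := x) (y := y) (z := z) hq0 hqα hα hγ hb hc
  have hET : lam < LamE q α γ a b c (tEmax q α γ a c) := by
    obtain ⟨y, ⟨t, ht, rfl⟩, hy⟩ := exists_lt_of_lt_csSup (by exact ⟨_, 1, one_pos, rfl⟩) hlam
    exact hy.trans_le (lamE_le_lamE_tEmax hq0 hqα hα hγ ha hb hc ht)
  have hNT : lam < LamN q α γ a b c (tEmax q α γ a c) := by
    have h := lamN_sub_lamE hqα hα hγ ha hb hc hT
    rw [sub_self, mul_zero, sub_eq_zero] at h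
    rwa [h]
  obtain ⟨hE1, hE2⟩ := mem_Ioo_of_lt_of_quasiconcave hqcE hep he hEp hEm hT hET
  obtain ⟨hN1, hN2⟩ := mem_Ioo_of_lt_of_quasiconcave hqcN hnp hn hNp hNm hT hNT
  have hcoef : ∀ t : ℝ, 0 < t →
      0 < (γ - α) * (γ - q) * c / (γ * ((α - q) * b)) * t ^ (2 - q) := fun t ht => by
    have h1 := sub_pos.2 hqα
    have h2 : 0 < γ - α := by linarith
    have h3 : 0 < γ - q := by linarith
    positivity
  have hNep : lam < LamN q α γ a b c tep := by
    have h := lamN_sub_lamE hqα hα hγ ha hb hc hep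
    have := mul_pos (hcoef tep hep) (sub_pos.2 (rpow_lt_rpow hep.le hE1 (sub_pos.2 hγ)))
    linarith
  have hNem : LamN q α γ a b c tem < lam := by
    have h := lamN_sub_lamE hqα hα hγ ha hb hc (hep.trans he)
    have := mul_neg_of_pos_of_neg (hcoef tem (hep.trans he))
      (sub_neg.2 (rpow_lt_rpow hT.le hE2 (sub_pos.2 hγ)))
    linarith
  refine ⟨(mem_Ioo_of_lt_of_quasiconcave hqcN hnp hn hNp hNm hep hNep).1, hE1, hN2, ?_⟩
  by_contra! hle
  rcases hle.eq_or_lt with rfl | hlt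
  · exact hNem.ne hNm
  · have := hqcN tnp tem tnm hnp (hN1.trans hE2) hlt
    rw [hNp, hNm, min_self] at this
    exact this.not_gt hNem

end
end
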